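/- arXiv:2205.05988 — 2 statements merged into one kernel-verified Lean document; each statement's English description precedes it below -/
import Mathlib

section
/- Let ω, μ₀, ε₀ > 0 and set ℓ(σ) = √(2/(ωμ₀σ)) and δ(σ) = √(ωε₀/σ) for σ > 0. Let 𝓗, c ∈ ℝ, C > 0 and h₀ > 0, and suppose that for every σ > 0 a continuous function f_σ : [0,h₀] → ℝ is given by f_σ(y) = (1 + 2𝓗y + 2cδ(σ) + R_σ(y))·exp(−2y/ℓ(σ)), where R_σ is continuous and |R_σ(y)| ≤ C(δ(σ)+y)² for all y ∈ [0,h₀]. Then there exist σ₀ > 0 and C′ > 0 such that for every σ ≥ σ₀ the set {y ∈ (0,h₀) : f_σ(y) = e^{−2} f_σ(0)} is nonempty and its least element L(σ) satisfies |L(σ) − ℓ(σ)(1 + 𝓗 ℓ(σ))| ≤ C′ ℓ(σ)/σ. In other words, the skin depth behaves as L(σ) = ℓ(σ)(1 + 𝓗 ℓ(σ) + O(σ^{−1})) as σ → ∞. -/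
open Real Set

/-- Sign of `(1 + 2Hℓt + aℓ + r) e^{-2t} - (1 + aℓ + r₀) e^{-2}` for small `ℓ` and `r, r₀ = O(ℓ²)`:
it is positive for `t` below `1 + Hℓ - Kℓ²` and negative at `1 + Hℓ + Kℓ²`. -/
lemma exists_skin_depth_bracket (H a M : ℝ) (hM : 0 ≤ M) :
    ∃ K > (0:ℝ), ∀ l > (0:ℝ), K * l ≤ 1 →
      (|H| + 1) * l ≤ 1 / 20 ∧ ∀ r r₀ : ℝ, |r| ≤ M * l ^ 2 → |r₀| ≤ M * l ^ 2 →
        (∀ t, 0 ≤ t → t ≤ 1 + H * l - K * l ^ 2 →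
          (1 + a * l + r₀) * exp (-2) < (1 + 2 * H * (l * t) + a * l + r) * exp (-2 * t)) ∧
        (∀ t, t = 1 + H * l + K * l ^ 2 →
          (1 + 2 * H * (l * t) + a * l + r) * exp (-2 * t) < (1 + a * l + r₀) * exp (-2)) := by
  obtain ⟨E, hE⟩ : ∃ E, E = |H| + 1 := ⟨_, rfl⟩
  have hH0 := abs_nonneg H
  have ha0 := abs_nonneg a
  obtain ⟨N, hN⟩ : ∃ N, N = 2 * |H| * E + 2 * |a| * E + 8 * E ^ 2 := ⟨_, rfl⟩
  have hE1 : 1 ≤ E := by linarith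
  have hN0 : 0 ≤ N := by rw [hN]; positivity
  obtain ⟨K, hK⟩ : ∃ K, K = N + 4 * M + 1 + 20 * E + 2 * |a| := ⟨_, rfl⟩
  have hK0 : 0 < K := by rw [hK]; linarith
  refine ⟨K, hK0, fun l hl hKl => ?_⟩
  have hEl : E * l ≤ 1 / 20 := by
    have : 20 * E * l ≤ K * l := mul_le_mul_of_nonneg_right (by linarith) hl.le
    linarith
  have hal : |a * l| ≤ 1 / 2 := by
    rw [abs_mul, abs_of_pos hl]
    have : 2 * |a| * l ≤ K * l := mul_le_mul_of_nonneg_right (by linarith) hl.le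
    linarith
  obtain ⟨hal1, hal2⟩ := abs_le.1 hal
  refine ⟨hE ▸ hEl, fun r r₀ hr hr₀ => ?_⟩
  obtain ⟨hr1, hr2⟩ := abs_le.1 hr
  have hl2 : 0 < l ^ 2 := by positivity
  have hHl : |H * l| = |H| * l := by rw [abs_mul, abs_of_pos hl]
  have hKl2 : K * l ^ 2 ≤ l := by
    linarith [mul_le_mul_of_nonneg_right hKl hl.le]
  have hKl20 : 0 < K * l ^ 2 := by positivity
  -- bounds common to both endpoints of the bracket
  have key : ∀ s, |s| ≤ E * l → exp (2 * s) ≤ 3 ∧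
      exp (2 * s) ≤ 1 + 2 * s + 4 * s ^ 2 ∧
      |2 * H * l * s| + |2 * a * l * s| + 8 * s ^ 2 ≤ N * l ^ 2 := by
    intro s hs
    have h1 : |2 * s| ≤ 1 := by rw [abs_mul, abs_two]; linarith
    have h2 := (abs_le.1 (abs_exp_sub_one_sub_id_le h1)).2
    have h3 := abs_le.1 h1
    have hs2 : s ^ 2 ≤ (E * l) ^ 2 := sq_le_sq' (abs_le.1 hs).1 (abs_le.1 hs).2
    have h4 : (2 * s) ^ 2 ≤ 1 := (sq_le_one_iff_abs_le_one _).2 h1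
    refine ⟨by linarith, by linarith, ?_⟩
    have e1 : |2 * H * l * s| ≤ 2 * |H| * l * (E * l) := by
      rw [abs_mul, abs_mul, abs_mul, abs_two, abs_of_pos hl]
      gcongr
    have e2 : |2 * a * l * s| ≤ 2 * |a| * l * (E * l) := by
      rw [abs_mul, abs_mul, abs_mul, abs_two, abs_of_pos hl]
      gcongr
    rw [hN]
    linarith
  have hKN : (N + 4 * M) * l ^ 2 < 2 * (K * l ^ 2) := by
    have : (N + 4 * M) * l ^ 2 < (2 * K) * l ^ 2 := mul_lt_mul_of_pos_right (by linarith) hl2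
    linarith
  have hr₀exp : ∀ x, 0 < x → x ≤ 3 → |r₀ * x| ≤ 3 * (M * l ^ 2) := by
    intro x hx hx3
    rw [abs_mul, abs_of_pos hx]
    linarith [mul_le_mul hr₀ hx3 hx.le (by positivity)]
  have hfac : ∀ t, exp (-2) = exp (2 * (t - 1)) * exp (-2 * t) := by
    intro t
    rw [← exp_add]; ring_nf
  have hH1 : -(|H| * l) ≤ H * l ∧ H * l ≤ |H| * l := by rw [← hHl]; exact ⟨neg_abs_le _, le_abs_self _⟩
  have hEle : E * l = |H| * l + l := by rw [hE]; ring
  constructor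
  · intro t ht0 ht
    rw [hfac t, ← mul_assoc (1 + a * l + r₀)]
    refine mul_lt_mul_of_pos_right ?_ (exp_pos _)
    obtain ⟨s, hs⟩ : ∃ s, s = t - 1 := ⟨_, rfl⟩
    obtain ⟨s₀, hs₀⟩ : ∃ s₀, s₀ = H * l - K * l ^ 2 := ⟨_, rfl⟩
    rw [← hs]
    obtain rfl : t = 1 + s := by linarith
    have hss : s ≤ s₀ := by linarith
    obtain ⟨k1, k2, k3⟩ := key s₀ (abs_le.2 ⟨by linarith, by linarith⟩)
    have hmono : exp (2 * s) ≤ exp (2 * s₀) := exp_le_exp.2 (by linarith)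
    have hrx := (abs_le.1 (hr₀exp _ (exp_pos (2 * s)) (hmono.trans k1))).2
    have hlow : 1 / 9 ≤ exp (2 * s) := by
      have h1 : exp (-2) ≤ exp (2 * s) := exp_le_exp.2 (by linarith)
      have h2 : exp 2 ≤ 9 := by
        have := exp_one_lt_d9
        have h3 : exp 2 = exp 1 * exp 1 := by rw [← exp_add]; norm_num
        rw [h3]
        linarith [mul_le_mul (this.le.trans (by norm_num : _ ≤ (3:ℝ))) (this.le.trans
          (by norm_num : _ ≤ (3:ℝ))) (exp_pos 1).le (by norm_num)]
      have h3 : 1 / 9 ≤ exp (-2) := by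
        rw [exp_neg, ← one_div]
        exact one_div_le_one_div_of_le (exp_pos _) h2
      linarith
    have hgap : 2 / 9 * (s₀ - s) ≤ exp (2 * s₀) - exp (2 * s) := by
      have h1 : exp (2 * s₀) = exp (2 * s) * exp (2 * (s₀ - s)) := by rw [← exp_add]; ring_nf
      have h2 := add_one_le_exp (2 * (s₀ - s))
      have h3 : exp (2 * s) * (2 * (s₀ - s) + 1) ≤ exp (2 * s) * exp (2 * (s₀ - s)) :=
        mul_le_mul_of_nonneg_left h2 (exp_pos _).le
      have h4 : 1 / 9 * (2 * (s₀ - s)) ≤ exp (2 * s) * (2 * (s₀ - s)) :=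
        mul_le_mul_of_nonneg_right hlow (by linarith)
      rw [h1]
      linarith
    have hA : H * l * (2 * (s₀ - s)) ≤ (1 + a * l) * (exp (2 * s₀) - exp (2 * s)) := by
      have h1 : 1 / 2 * (2 / 9 * (s₀ - s)) ≤ (1 + a * l) * (exp (2 * s₀) - exp (2 * s)) :=
        mul_le_mul (by linarith) hgap (by linarith) (by linarith)
      have h2 : H * l * (2 * (s₀ - s)) ≤ 1 / 20 * (2 * (s₀ - s)) :=
        mul_le_mul_of_nonneg_right (by linarith) (by linarith)
      linarith
    have hB : (1 + a * l) * exp (2 * s₀) ≤ (1 + a * l) * (1 + 2 * s₀ + 4 * s₀ ^ 2) :=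
      mul_le_mul_of_nonneg_left k2 (by linarith)
    have hD : a * l * s₀ ^ 2 ≤ 1 * s₀ ^ 2 := mul_le_mul_of_nonneg_right (by linarith) (sq_nonneg _)
    have n1 := neg_abs_le (2 * H * l * s₀)
    have n2 := le_abs_self (2 * a * l * s₀)
    linarith
  · intro t ht
    rw [hfac t, ← mul_assoc (1 + a * l + r₀)]
    refine mul_lt_mul_of_pos_right ?_ (exp_pos _)
    obtain ⟨s, hs⟩ : ∃ s, s = t - 1 := ⟨_, rfl⟩
    rw [← hs]
    obtain rfl : t = 1 + s := by linarith
    obtain ⟨k1, -, k3⟩ := key s (abs_le.2 ⟨by linarith, by linarith⟩)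
    have hrx := (abs_le.1 (hr₀exp _ (exp_pos (2 * s)) k1)).1
    have hB : (1 + a * l) * (1 + 2 * s) ≤ (1 + a * l) * exp (2 * s) :=
      mul_le_mul_of_nonneg_left (by linarith [add_one_le_exp (2 * s)]) (by linarith)
    have n1 := le_abs_self (2 * H * l * s)
    have n2 := neg_abs_le (2 * a * l * s)
    have n3 := sq_nonneg s
    linarith

/-- If `g` is continuous on `[0, h]`, differs from `v` on `(0, p)`, and crosses `v` between `p` and
`q`, then the least point of `(0, h)` where `g = v` exists and lies in `[p, q]`. -/
lemma exists_isLeast_eq_mem_Icc {g : ℝ → ℝ} {h p q v : ℝ} (hg : ContinuousOn g (Icc 0 h))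
    (hp : 0 < p) (hpq : p ≤ q) (hq : q < h) (hne : ∀ y, 0 < y → y < p → g y ≠ v)
    (hvp : v ≤ g p) (hvq : g q ≤ v) :
    ∃ L, IsLeast {y ∈ Ioo (0:ℝ) h | g y = v} L ∧ L ∈ Icc p q := by
  have hg' : ContinuousOn g (Icc p q) := hg.mono (Icc_subset_Icc hp.le hq.le)
  obtain ⟨x, hx, hxv⟩ := intermediate_value_Icc' hpq hg' ⟨hvq, hvp⟩
  have hcomp : IsCompact (Icc p q ∩ g ⁻¹' {v}) :=
    isCompact_Icc.of_isClosed_subset (hg'.preimage_isClosed_of_isClosed isClosed_Icc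
      isClosed_singleton) inter_subset_left
  obtain ⟨L, ⟨hL, hLv⟩, hLmin⟩ := hcomp.exists_isLeast ⟨x, hx, hxv⟩
  refine ⟨L, ⟨⟨⟨hp.trans_le hL.1, hL.2.trans_lt hq⟩, hLv⟩, ?_⟩, hL⟩
  rintro y ⟨⟨hy0, hyh⟩, hyv⟩
  by_contra! hyL
  rcases lt_or_ge y p with hyp | hyp
  · exact hne y hy0 hyp hyv
  · exact (hLmin ⟨⟨hyp, hyL.le.trans hL.2⟩, hyv⟩).not_gt hyL

/-- Asymptotic behavior of the skin depth: `L(σ) = ℓ(σ)(1 + 𝓗 ℓ(σ) + O(σ⁻¹))` as `σ → ∞`. -/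
theorem skin_depth_asymptotics
    (ω μ₀ ε₀ : ℝ) (hω : 0 < ω) (hμ : 0 < μ₀) (hε : 0 < ε₀)
    (ℓ δ : ℝ → ℝ)
    (hℓ : ∀ σ > (0:ℝ), ℓ σ = Real.sqrt (2 / (ω * μ₀ * σ)))
    (hδ : ∀ σ > (0:ℝ), δ σ = Real.sqrt (ω * ε₀ / σ))
    (𝓗 c C : ℝ) (hC : 0 < C) (h₀ : ℝ) (hh₀ : 0 < h₀)
    (f R : ℝ → ℝ → ℝ)
    (hfc : ∀ σ > (0:ℝ), ContinuousOn (f σ) (Icc 0 h₀))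
    (hRc : ∀ σ > (0:ℝ), ContinuousOn (R σ) (Icc 0 h₀))
    (hf : ∀ σ > (0:ℝ), ∀ y ∈ Icc (0:ℝ) h₀,
      f σ y = (1 + 2 * 𝓗 * y + 2 * c * δ σ + R σ y) * Real.exp (-2 * y / ℓ σ))
    (hR : ∀ σ > (0:ℝ), ∀ y ∈ Icc (0:ℝ) h₀, |R σ y| ≤ C * (δ σ + y) ^ 2) :
    ∃ σ₀ > (0:ℝ), ∃ C' > (0:ℝ), ∀ σ ≥ σ₀,
      ∃ L, IsLeast {y ∈ Ioo (0:ℝ) h₀ | f σ y = Real.exp (-2) * f σ 0} L ∧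
        |L - ℓ σ * (1 + 𝓗 * ℓ σ)| ≤ C' * ℓ σ / σ := by
  obtain ⟨κ, hκ⟩ : ∃ κ, κ = √(ω * ε₀ * (ω * μ₀) / 2) := ⟨_, rfl⟩
  have hκ0 : 0 ≤ κ := hκ ▸ sqrt_nonneg _
  obtain ⟨M, hM⟩ : ∃ M, M = C * (κ + 2) ^ 2 := ⟨_, rfl⟩
  obtain ⟨K, hK0, hK⟩ := exists_skin_depth_bracket 𝓗 (2 * c * κ) M (by rw [hM]; positivity)
  obtain ⟨η, hη⟩ : ∃ η, η = min (1 / K) (h₀ / 4) := ⟨_, rfl⟩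
  have hη0 : 0 < η := by rw [hη]; positivity
  refine ⟨2 / (ω * μ₀ * η ^ 2), by positivity, K * (2 / (ω * μ₀)), by positivity, fun σ hσ => ?_⟩
  have hσ0 : 0 < σ := lt_of_lt_of_le (by positivity) hσ
  obtain ⟨l, hl⟩ : ∃ l, l = ℓ σ := ⟨_, rfl⟩
  have hl0 : 0 < l := by rw [hl, hℓ σ hσ0]; positivity
  have hl2 : l ^ 2 = 2 / (ω * μ₀ * σ) := by
    rw [hl, hℓ σ hσ0, sq_sqrt (by positivity)]
  have hlη : l ≤ η := by
    rw [hl, hℓ σ hσ0]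
    refine sqrt_le_iff.2 ⟨hη0.le, ?_⟩
    rw [ge_iff_le, div_le_iff₀ (by positivity)] at hσ
    rw [div_le_iff₀ (by positivity)]
    linarith
  have hδl : δ σ = κ * l := by
    rw [hδ σ hσ0, hl, hℓ σ hσ0, hκ, ← sqrt_mul (by positivity)]
    congr 1
    field_simp
  have hKl : K * l ≤ 1 := by
    have : l ≤ 1 / K := hlη.trans (hη ▸ min_le_left _ _)
    rw [le_div_iff₀ hK0] at this
    linarith
  have hlh : l ≤ h₀ / 4 := hlη.trans (hη ▸ min_le_right _ _)
  obtain ⟨hEl, hbr⟩ := hK l hl0 hKl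
  have hHl : |𝓗 * l| ≤ 1 / 20 := by
    rw [abs_mul, abs_of_pos hl0]; linarith
  obtain ⟨hHl1, hHl2⟩ := abs_le.1 hHl
  have hl20 : l ≤ 1 / 20 := by nlinarith [abs_nonneg 𝓗]
  have hKl2 : K * l ^ 2 ≤ l := by
    linarith [mul_le_mul_of_nonneg_right hKl hl0.le]
  have hKl20 : 0 < K * l ^ 2 := by positivity
  have hmem : ∀ t, 0 ≤ t → t ≤ 2 → l * t ∈ Icc 0 h₀ := fun t h0 h2 =>
    ⟨by positivity, by nlinarith⟩
  have hRl : ∀ t, 0 ≤ t → t ≤ 2 → |R σ (l * t)| ≤ M * l ^ 2 := by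
    intro t h0 h2
    refine (hR σ hσ0 _ (hmem t h0 h2)).trans ?_
    rw [hδl, hM, show κ * l + l * t = (κ + t) * l by ring, mul_pow, ← mul_assoc]
    gcongr
  have hfl : ∀ t, 0 ≤ t → t ≤ 2 → f σ (l * t) =
      (1 + 2 * 𝓗 * (l * t) + 2 * c * κ * l + R σ (l * t)) * exp (-2 * t) := by
    intro t h0 h2
    rw [hf σ hσ0 _ (hmem t h0 h2), hδl, ← hl]
    congr 2
    · ring
    · field_simp
  have hR0 : |R σ 0| ≤ M * l ^ 2 := by simpa using hRl 0 le_rfl zero_le_two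
  have hf0 : exp (-2) * f σ 0 = (1 + 2 * c * κ * l + R σ 0) * exp (-2) := by
    have := hfl 0 le_rfl zero_le_two
    simp only [mul_zero, add_zero, exp_zero, mul_one] at this
    rw [this, mul_comm]
  have hlt : ∀ t, 0 ≤ t → t ≤ 1 + 𝓗 * l - K * l ^ 2 → exp (-2) * f σ 0 < f σ (l * t) := by
    intro t h0 ht
    have h2 : t ≤ 2 := by linarith
    rw [hf0, hfl t h0 h2]
    exact (hbr _ _ (hRl t h0 h2) hR0).1 t h0 ht
  have hgt : f σ (l * (1 + 𝓗 * l + K * l ^ 2)) ≤ exp (-2) * f σ 0 := by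
    have h0 : 0 ≤ 1 + 𝓗 * l + K * l ^ 2 := by linarith
    have h2 : 1 + 𝓗 * l + K * l ^ 2 ≤ 2 := by linarith
    rw [hf0, hfl _ h0 h2]
    exact ((hbr _ _ (hRl _ h0 h2) hR0).2 _ rfl).le
  have hp0 : 0 < 1 + 𝓗 * l - K * l ^ 2 := by linarith
  obtain ⟨L, hL, hLp, hLq⟩ := exists_isLeast_eq_mem_Icc (hfc σ hσ0)
    (p := l * (1 + 𝓗 * l - K * l ^ 2)) (q := l * (1 + 𝓗 * l + K * l ^ 2))
    (by positivity) (by gcongr; linarith) (by nlinarith)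
    (fun y hy0 hyp => by
      have := hlt (y / l) (by positivity) ((div_lt_iff₀' hl0).2 hyp).le
      rw [mul_div_cancel₀ _ hl0.ne'] at this
      exact this.ne') (hlt _ hp0.le le_rfl).le hgt
  refine ⟨L, hL, ?_⟩
  have hC' : K * (2 / (ω * μ₀)) * ℓ σ / σ = l * (K * l ^ 2) := by
    rw [hl2, ← hl]; field_simp
  rw [hC', ← hl, abs_le]
  constructor <;> linarith
end

section
/- Let ω, μ₀, ε₀ > 0 and set ℓ(σ) = √(2/(ωμ₀σ)) and δ(σ) = √(ωε₀/σ). Let 𝓗₁ < 𝓗₂ be real numbers, c₁, c₂ ∈ ℝ, C > 0, h₀ > 0, and for i = 1,2 and σ > 0 let f_σ^i : [0,h₀] → ℝ be continuous with f_σ^i(y) = (1 + 2𝓗ᵢy + 2cᵢδ(σ) + R_σ^i(y))·exp(−2y/ℓ(σ)) and |R_σ^i(y)| ≤ C(δ(σ)+y)². For σ large enough let Lᵢ(σ) be the smallest y ∈ (0,h₀) with f_σ^i(y) = e^{−2} f_σ^i(0). Then there exists σ₁ > 0 such that L₁(σ) < L₂(σ) for all σ ≥ σ₁; that is, at high conductivity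 the skin depth is strictly larger where the mean curvature of the conductor surface is larger. -/
open Real Set

open Filter Topology in
lemma eventually_mul_lt_nhdsGT_zero (M : ℝ) {a : ℝ} (ha : 0 < a) :
    ∀ᶠ x : ℝ in 𝓝[>] 0, x * M < a := by
  have h : Tendsto (fun x : ℝ => x * M) (𝓝 0) (𝓝 0) := by
    simpa using (continuous_mul_const M).tendsto (0 : ℝ)
  exact (h.eventually_lt_const ha).filter_mono nhdsWithin_le_nhds

lemma abs_le_of_abs_le_mul_add_sq {C k l y r : ℝ} (hC : 0 ≤ C) (hk : 0 ≤ k) (hl : 0 ≤ l)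
    (hy : 0 ≤ y) (hyl : y ≤ 2 * l) (hr : |r| ≤ C * (k * l + y) ^ 2) :
    |r| ≤ C * (k + 2) ^ 2 * l ^ 2 := by
  have h : (k * l + y) ^ 2 ≤ ((k + 2) * l) ^ 2 := by
    have := mul_nonneg hk hl
    gcongr
    linarith
  calc |r| ≤ C * (k * l + y) ^ 2 := hr
    _ ≤ C * ((k + 2) * l) ^ 2 := by gcongr
    _ = C * (k + 2) ^ 2 * l ^ 2 := by ring

/-- A perturbed exponential profile falls below `e⁻²` times its surface value before depth
`l + h * l ^ 2`, when `h` exceeds the curvature `H` and `l` is small. -/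
lemma eventually_exists_isLeast_lt (H h c C k h₀ : ℝ) (hH : H < h) (hC : 0 ≤ C) (hk : 0 ≤ k)
    (hh₀ : 0 < h₀) :
    ∀ᶠ l : ℝ in nhdsWithin 0 (Ioi 0), ∀ f R : ℝ → ℝ, ContinuousOn f (Icc 0 h₀) →
      (∀ y ∈ Icc (0 : ℝ) h₀,
        f y = (1 + 2 * H * y + 2 * c * (k * l) + R y) * exp (-2 * y / l)) →
      (∀ y ∈ Icc (0 : ℝ) h₀, |R y| ≤ C * (k * l + y) ^ 2) →
      ∃ L, IsLeast {y ∈ Ioo (0 : ℝ) h₀ | f y = exp (-2) * f 0} L ∧ L < l + h * l ^ 2 := by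
  set K := C * (k + 2) ^ 2 with hK
  have hK0 : 0 ≤ K := by positivity
  filter_upwards [self_mem_nhdsWithin, eventually_mul_lt_nhdsGT_zero 1 one_pos,
    eventually_mul_lt_nhdsGT_zero 2 hh₀, eventually_mul_lt_nhdsGT_zero |h| one_pos,
    eventually_mul_lt_nhdsGT_zero (2 * |c * k| + K) one_pos,
    eventually_mul_lt_nhdsGT_zero (|4 * h * (c * k) - 2 * H * h| + 4 * K)
      (by linarith : 0 < 2 * (h - H))] with l hl hl1 hlh₀ hlh hlB hlM f R hfc hf hR
  rw [mem_Ioi] at hl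
  obtain ⟨hlh₁, hlh₂⟩ : -1 < h * l ∧ h * l < 1 := by
    rw [← abs_lt, abs_mul, abs_of_pos hl]; linarith
  set m := l + h * l ^ 2 with hm
  have hm0 : 0 < m := by nlinarith
  have hm2 : m ≤ 2 * l := by nlinarith
  have hmh : m < h₀ := by linarith
  have h0mem : (0 : ℝ) ∈ Icc 0 h₀ := ⟨le_rfl, hh₀.le⟩
  have hmmem : m ∈ Icc 0 h₀ := ⟨hm0.le, hmh.le⟩
  have hR0 := abs_le.1
    (abs_le_of_abs_le_mul_add_sq hC hk hl.le le_rfl (by linarith) (hR 0 h0mem))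
  have hRm := abs_le.1 (abs_le_of_abs_le_mul_add_sq hC hk hl.le hm0.le hm2 (hR m hmmem))
  rw [← hK] at hR0 hRm
  have hf0 : f 0 = 1 + 2 * (c * k) * l + R 0 := by
    rw [hf 0 h0mem]; simp; ring
  have hll : K * l ^ 2 ≤ K * l := by
    apply mul_le_mul_of_nonneg_left _ hK0; nlinarith
  have hpos : 0 < f 0 := by
    rw [hf0]
    nlinarith [neg_abs_le (c * k)]
  have hcorr : -(2 * (K * l ^ 2)) ≤ 2 * (h * l) * R 0 := by
    have : |h * l * R 0| ≤ 1 * (K * l ^ 2) := by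
      rw [abs_mul]
      exact mul_le_mul (abs_le.2 ⟨hlh₁.le, hlh₂.le⟩) (abs_le.2 hR0) (abs_nonneg _) zero_le_one
    linarith [(abs_le.1 this).1]
  have hlin : 1 + 2 * H * m + 2 * c * (k * l) + R m < f 0 * (2 * (h * l) + 1) := by
    have h1 := mul_lt_mul_of_pos_left hlM hl
    have h2 := mul_le_mul_of_nonneg_left (neg_abs_le (4 * h * (c * k) - 2 * H * h)) (sq_nonneg l)
    rw [hf0, hm]
    linarith
  have hfm : f m < exp (-2) * f 0 := by
    have hexp : -2 * m / l = -2 + -(2 * (h * l)) := by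
      rw [hm]; field_simp; ring
    rw [hf m hmmem, hexp, exp_add, mul_comm, mul_assoc]
    apply mul_lt_mul_of_pos_left _ (exp_pos _)
    rw [exp_neg, inv_mul_lt_iff₀ (exp_pos _)]
    calc _ < f 0 * (2 * (h * l) + 1) := hlin
      _ ≤ f 0 * exp (2 * (h * l)) := mul_le_mul_of_nonneg_left (add_one_le_exp _) hpos.le
      _ = _ := mul_comm _ _
  have hf0lt : exp (-2) * f 0 < f 0 := by
    have : exp (-2) < 1 := exp_lt_one_iff.2 (by norm_num)
    nlinarith
  have hcm : ContinuousOn f (Icc 0 m) := hfc.mono (Icc_subset_Icc_right hmh.le)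
  have hne : (Icc 0 m ∩ f ⁻¹' {exp (-2) * f 0}).Nonempty := by
    obtain ⟨y, hy, hfy⟩ := intermediate_value_Icc' hm0.le hcm ⟨hfm.le, hf0lt.le⟩
    exact ⟨y, hy, hfy⟩
  have hcomp : IsCompact (Icc 0 m ∩ f ⁻¹' {exp (-2) * f 0}) :=
    isCompact_Icc.of_isClosed_subset
      (hcm.preimage_isClosed_of_isClosed isClosed_Icc isClosed_singleton) inter_subset_left
  obtain ⟨L, ⟨⟨hL0, hLm⟩, hfL⟩, hLmin⟩ := hcomp.exists_isLeast hne
  rw [mem_preimage, mem_singleton_iff] at hfL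
  have hLpos : 0 < L := by
    rcases hL0.eq_or_lt with rfl | hlt
    · exact absurd hfL hf0lt.ne'
    · exact hlt
  have hLlt : L < m := by
    rcases hLm.eq_or_lt with rfl | hlt
    · exact absurd hfL hfm.ne
    · exact hlt
  refine ⟨L, ⟨⟨⟨hLpos, hLlt.trans hmh⟩, hfL⟩, ?_⟩, hLlt⟩
  rintro y ⟨⟨hy0, -⟩, hfy⟩
  rcases le_total y m with hym | hym
  · exact hLmin ⟨⟨hy0.le, hym⟩, hfy⟩
  · exact hLm.trans hym

/-- A perturbed exponential profile stays above `e⁻²` times its surface value up to depth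
`l + h * l ^ 2`, when `h` is below the curvature `H` and `l` is small. -/
lemma eventually_forall_exp_mul_lt (H h c C k h₀ : ℝ) (hH : h < H) (hC : 0 ≤ C) (hk : 0 ≤ k)
    (hh₀ : 0 < h₀) :
    ∀ᶠ l : ℝ in nhdsWithin 0 (Ioi 0), ∀ f R : ℝ → ℝ,
      (∀ y ∈ Icc (0 : ℝ) h₀,
        f y = (1 + 2 * H * y + 2 * c * (k * l) + R y) * exp (-2 * y / l)) →
      (∀ y ∈ Icc (0 : ℝ) h₀, |R y| ≤ C * (k * l + y) ^ 2) →
      ∀ y, 0 ≤ y → y ≤ l + h * l ^ 2 → exp (-2) * f 0 < f y := by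
  set K := C * (k + 2) ^ 2 with hK
  have hK0 : 0 ≤ K := by positivity
  set N := 4 * |H| + 2 * |c * k| + K with hN
  filter_upwards [self_mem_nhdsWithin, eventually_mul_lt_nhdsGT_zero 1 one_pos,
    eventually_mul_lt_nhdsGT_zero 2 hh₀, eventually_mul_lt_nhdsGT_zero |h| one_pos,
    eventually_mul_lt_nhdsGT_zero (N + |H|) one_pos,
    eventually_mul_lt_nhdsGT_zero (2 * |H * h| + 2 * K + 2 * (|h| * N))
      (by linarith : 0 < 2 * (H - h))] with l hl hl1 hlh₀ hlh hlN hlM f R hf hR y hy0 hym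
  rw [mem_Ioi] at hl
  obtain ⟨hlh₁, hlh₂⟩ : -1 < h * l ∧ h * l < 1 := by
    rw [← abs_lt, abs_mul, abs_of_pos hl]; linarith
  have hy2 : y ≤ 2 * l := by nlinarith
  have h0mem : (0 : ℝ) ∈ Icc 0 h₀ := ⟨le_rfl, hh₀.le⟩
  have hymem : y ∈ Icc 0 h₀ := ⟨hy0, by linarith⟩
  have hR0 := abs_le.1
    (abs_le_of_abs_le_mul_add_sq hC hk hl.le le_rfl (by linarith) (hR 0 h0mem))
  have hRy := abs_le_of_abs_le_mul_add_sq hC hk hl.le hy0 hy2 (hR y hymem)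
  rw [← hK] at hR0 hRy
  have hf0 : f 0 = 1 + 2 * (c * k) * l + R 0 := by
    rw [hf 0 h0mem]; simp; ring
  have hll : K * l ^ 2 ≤ K * l := by
    apply mul_le_mul_of_nonneg_left _ hK0; nlinarith
  set A := 1 + 2 * H * y + 2 * c * (k * l) + R y with hA
  have hA1 : |A - 1| ≤ N * l := by
    have e1 : |2 * H * y| ≤ 4 * |H| * l := by
      rw [abs_mul, abs_mul, abs_of_nonneg hy0, abs_two]
      nlinarith [abs_nonneg H]
    have e2 : |2 * c * (k * l)| = 2 * |c * k| * l := by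
      rw [show 2 * c * (k * l) = 2 * (c * k) * l by ring, abs_mul, abs_mul, abs_two,
        abs_of_pos hl]
    calc |A - 1| = |2 * H * y + 2 * c * (k * l) + R y| := by rw [hA]; congr 1; ring
      _ ≤ |2 * H * y| + |2 * c * (k * l)| + |R y| := abs_add_three _ _ _
      _ ≤ N * l := by rw [e2, hN]; linarith
  have hAH : 0 < A - H * l := by
    have := (abs_le.1 hA1).1
    nlinarith [le_abs_self H]
  have hApos : 0 < A := by
    have := (abs_le.1 hA1).1
    nlinarith [abs_nonneg H]
  have hcorr : h * l * (A - 1) ≤ |h| * N * l ^ 2 := by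
    calc h * l * (A - 1) ≤ |h * l * (A - 1)| := le_abs_self _
      _ = |h| * l * |A - 1| := by rw [abs_mul, abs_mul, abs_of_pos hl]
      _ ≤ |h| * l * (N * l) := by gcongr
      _ = _ := by ring
  have hlin : f 0 < A * (2 - 2 * y / l + 1) := by
    have h1 := mul_lt_mul_of_pos_left hlM hl
    have h2 := mul_le_mul_of_nonneg_left (neg_abs_le (H * h)) (sq_nonneg l)
    have h3 : 0 ≤ (l + h * l ^ 2 - y) / l * (A - H * l) :=
      mul_nonneg (div_nonneg (by linarith) hl.le) hAH.le
    have h4 : A * (2 - 2 * y / l + 1) - f 0 =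
        2 * (H - h) * l + 2 * (H * h) * l ^ 2 - 2 * (h * l * (A - 1)) + R y - R 0
          + 2 * ((l + h * l ^ 2 - y) / l * (A - H * l)) := by
      rw [hf0, hA]; field_simp; ring
    linarith [(abs_le.1 hRy).1]
  have hexp : -2 * y / l = -2 + (2 - 2 * y / l) := by ring
  rw [hf y hymem, hexp, exp_add, mul_left_comm]
  apply mul_lt_mul_of_pos_left _ (exp_pos _)
  exact hlin.trans_le (mul_le_mul_of_nonneg_left (add_one_le_exp _) hApos.le)

/-- At high conductivity, the skin depth is strictly larger where the mean curvature of
the conductor surface is larger. -/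
theorem skin_depth_monotone_in_curvature
    (ω μ₀ ε₀ : ℝ) (hω : 0 < ω) (hμ : 0 < μ₀) (hε : 0 < ε₀)
    (ℓ δ : ℝ → ℝ)
    (hℓ : ∀ σ > (0:ℝ), ℓ σ = Real.sqrt (2 / (ω * μ₀ * σ)))
    (hδ : ∀ σ > (0:ℝ), δ σ = Real.sqrt (ω * ε₀ / σ))
    (𝓗₁ 𝓗₂ : ℝ) (h𝓗 : 𝓗₁ < 𝓗₂) (c₁ c₂ C : ℝ) (hC : 0 < C) (h₀ : ℝ) (hh₀ : 0 < h₀)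
    (f₁ f₂ R₁ R₂ : ℝ → ℝ → ℝ)
    (hfc₁ : ∀ σ > (0:ℝ), ContinuousOn (f₁ σ) (Icc 0 h₀))
    (hfc₂ : ∀ σ > (0:ℝ), ContinuousOn (f₂ σ) (Icc 0 h₀))
    (hf₁ : ∀ σ > (0:ℝ), ∀ y ∈ Icc (0:ℝ) h₀,
      f₁ σ y = (1 + 2 * 𝓗₁ * y + 2 * c₁ * δ σ + R₁ σ y) * Real.exp (-2 * y / ℓ σ))
    (hf₂ : ∀ σ > (0:ℝ), ∀ y ∈ Icc (0:ℝ) h₀,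
      f₂ σ y = (1 + 2 * 𝓗₂ * y + 2 * c₂ * δ σ + R₂ σ y) * Real.exp (-2 * y / ℓ σ))
    (hR₁ : ∀ σ > (0:ℝ), ∀ y ∈ Icc (0:ℝ) h₀, |R₁ σ y| ≤ C * (δ σ + y) ^ 2)
    (hR₂ : ∀ σ > (0:ℝ), ∀ y ∈ Icc (0:ℝ) h₀, |R₂ σ y| ≤ C * (δ σ + y) ^ 2) :
    ∃ σ₁ > (0:ℝ), ∀ σ ≥ σ₁,
      ∃ L₁ L₂,
        IsLeast {y ∈ Ioo (0:ℝ) h₀ | f₁ σ y = Real.exp (-2) * f₁ σ 0} L₁ ∧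
        IsLeast {y ∈ Ioo (0:ℝ) h₀ | f₂ σ y = Real.exp (-2) * f₂ σ 0} L₂ ∧
        L₁ < L₂ := by
  set k := √(ω ^ 2 * ε₀ * μ₀ / 2) with hk
  have hk0 : 0 ≤ k := sqrt_nonneg _
  have hδk : ∀ σ > (0 : ℝ), δ σ = k * ℓ σ := by
    intro σ hσ
    rw [hδ σ hσ, hℓ σ hσ, hk, ← sqrt_mul (by positivity)]
    congr 1
    field_simp
  have hlim : Filter.Tendsto ℓ Filter.atTop (nhdsWithin 0 (Ioi 0)) := by
    have hpos : ∀ᶠ σ : ℝ in Filter.atTop, 0 < σ := Filter.eventually_gt_atTop 0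
    refine tendsto_nhdsWithin_iff.2 ⟨?_, ?_⟩
    · have h1 : Filter.Tendsto (fun σ : ℝ => √(2 / (ω * μ₀ * σ))) Filter.atTop (nhds 0) := by
        have h2 : Filter.Tendsto (fun σ : ℝ => 2 / (ω * μ₀ * σ)) Filter.atTop (nhds 0) :=
          (Filter.tendsto_id.const_mul_atTop (mul_pos hω hμ)).const_div_atTop 2
        simpa using h2.sqrt
      exact h1.congr' (hpos.mono fun σ hσ => (hℓ σ hσ).symm)
    · filter_upwards [hpos] with σ hσ
      rw [mem_Ioi, hℓ σ hσ]
      positivity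
  obtain ⟨h, hh₁, hh₂⟩ := exists_between h𝓗
  obtain ⟨σ₁, hσ₁⟩ := Filter.eventually_atTop.1
    (((hlim.eventually (eventually_exists_isLeast_lt 𝓗₁ h c₁ C k h₀ hh₁ hC.le hk0 hh₀)).and
    (hlim.eventually (eventually_exists_isLeast_lt 𝓗₂ (𝓗₂ + 1) c₂ C k h₀ (lt_add_one _) hC.le
      hk0 hh₀))).and
    (hlim.eventually (eventually_forall_exp_mul_lt 𝓗₂ h c₂ C k h₀ hh₂ hC.le hk0 hh₀)))
  refine ⟨max σ₁ 1, by positivity, fun σ hσ => ?_⟩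
  have hσ0 : 0 < σ := one_pos.trans_le ((le_max_right _ _).trans hσ)
  obtain ⟨⟨hup₁, hup₂⟩, hlow⟩ := hσ₁ σ ((le_max_left _ _).trans hσ)
  have hf₁' := hf₁ σ hσ0
  have hf₂' := hf₂ σ hσ0
  have hR₁' := hR₁ σ hσ0
  have hR₂' := hR₂ σ hσ0
  simp only [hδk σ hσ0] at hf₁' hf₂' hR₁' hR₂'
  obtain ⟨L₁, hL₁, hL₁h⟩ := hup₁ (f₁ σ) (R₁ σ) (hfc₁ σ hσ0) hf₁' hR₁'
  obtain ⟨L₂, hL₂, -⟩ := hup₂ (f₂ σ) (R₂ σ) (hfc₂ σ hσ0) hf₂' hR₂'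
  refine ⟨L₁, L₂, hL₁, hL₂, hL₁h.trans (lt_of_not_ge fun hle => ?_)⟩
  exact (hlow (f₂ σ) (R₂ σ) hf₂' hR₂' L₂ hL₂.1.1.1.le hle).ne' hL₂.1.2
end
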